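/- Let σ : ℝ → ℝ be C¹ and 2π-periodic, and let f ∈ C^∞(ℝ) be compactly supported with f(0)=0. For an integer ℓ ≥ 2 let Z_ℓ(σ) be the (ℓ−1)×(ℓ−1) Hermitian matrix with entries Z_ℓ(σ)_{j,k} = (4/π)·(1−(m_j/ℓ)²)^{−1/4}·(1−(m_k/ℓ)²)^{−1/4}·(1/(2π))·∫_{−π}^{π} σ(φ)·e^{i(m_j−m_k)φ} dφ, where m_j = 2j − ℓ + 2 for j,k ∈ {0,…,ℓ−2}. Then lim_{ℓ→∞} (1/(ℓ+1)) · Σ_{k=1}^{ℓ−1} f(λ_k(Z_ℓ(σ))) = (1/(4π)) · ∫_{−π}^{π} ∫_{−1}^{1} f( 4·σ_even(φ) / (π·√(1−ξ²)) ) dξ dφ, where λ_1(Z_ℓ(σ)) ≤ … ≤ λ_{ℓ−1}(Z_ℓ(σ)) are the eigenvalues of Z_ℓ(σ) listed in non-decreasing order with multiplicity. -/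

import Mathlib

open Real Filter Finset

/-- The (ℓ−1)×(ℓ−1) Hermitian matrix Z_ℓ(σ) with entries
Z_ℓ(σ)_{j,k} = (4/π)·(1−(m_j/ℓ)²)^{−1/4}·(1−(m_k/ℓ)²)^{−1/4}·(1/(2π))·∫ σ(φ)·e^{i(m_j−m_k)φ} dφ,
where m_j = 2j − ℓ + 2. -/
noncomputable def Zmat (σ : ℝ → ℝ) (ℓ : ℕ) : Matrix (Fin (ℓ-1)) (Fin (ℓ-1)) ℂ :=
  fun j k =>
    (((4/Real.pi) *
      (1 - (((2*(j:ℤ) - (ℓ:ℤ) + 2 : ℤ) : ℝ) / (ℓ:ℝ))^2) ^ (-(1/4) : ℝ) *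
      (1 - (((2*(k:ℤ) - (ℓ:ℤ) + 2 : ℤ) : ℝ) / (ℓ:ℝ))^2) ^ (-(1/4) : ℝ) *
      (1/(2*Real.pi)) : ℝ) : ℂ) *
      ∫ φ in (-Real.pi)..Real.pi,
        (σ φ : ℂ) * Complex.exp (Complex.I * (((2*((j:ℤ) - (k:ℤ))) : ℤ) : ℂ) * (φ : ℂ))

open MeasureTheory Topology

theorem im_inv_ofReal_sub (x y ε : ℝ) :
    (((x : ℂ) - (y + ε * Complex.I))⁻¹).im = ε / ((x - y) ^ 2 + ε ^ 2) := by
  simp [Complex.inv_im, Complex.normSq_apply, sq]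

theorem norm_inv_ofReal_sub_le (x : ℝ) {z : ℂ} (hz : 0 < z.im) :
    ‖((x : ℂ) - z)⁻¹‖ ≤ z.im⁻¹ := by
  rw [norm_inv]
  gcongr
  simpa [abs_of_pos hz] using Complex.abs_im_le_norm ((x : ℂ) - z)

theorem measurable_inv_ofReal_sub (z : ℂ) : Measurable fun x : ℝ => ((x : ℂ) - z)⁻¹ := by
  fun_prop

/-- The Poisson integral of `f` at height `ε`, recovered from the resolvent kernel. -/
noncomputable def poissonSmoothing (f : ℝ → ℝ) (ε x : ℝ) : ℝ :=
  π⁻¹ * ∫ y, f y * (((x : ℂ) - (y + ε * Complex.I))⁻¹).im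

theorem poissonSmoothing_eq (f : ℝ → ℝ) {ε : ℝ} (hε : 0 < ε) (x : ℝ) :
    poissonSmoothing f ε x = π⁻¹ * ∫ t, f (x + ε * t) * (1 + t ^ 2)⁻¹ := by
  rw [poissonSmoothing]
  congr 1
  simp_rw [im_inv_ofReal_sub]
  rw [← integral_add_left_eq_self _ x]
  have := Measure.integral_comp_mul_left (fun y => f (x + y) * (ε / ((x - (x + y)) ^ 2 + ε ^ 2))) ε
  rw [eq_comm, abs_of_pos (by positivity), smul_eq_mul, inv_mul_eq_iff_eq_mul₀ hε.ne'] at this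
  rw [this, ← integral_const_mul]
  congr 1 with t
  field_simp
  ring

theorem exists_poissonSmoothing_close {f : ℝ → ℝ} (hf : Continuous f) (hs : HasCompactSupport f)
    {δ : ℝ} (hδ : 0 < δ) : ∃ ε > 0, ∀ x, |poissonSmoothing f ε x - f x| ≤ δ := by
  obtain ⟨M, hM⟩ := hs.exists_bound_of_continuous hf
  have huc := hs.uniformContinuous_of_continuous hf
  have hint : Integrable fun t : ℝ => (1 + t ^ 2)⁻¹ := integrable_inv_one_add_sq
  have hlim : Tendsto (fun q : ℝ × ℝ => ∫ t, (f (q.2 + q.1 * t) - f q.2) * (1 + t ^ 2)⁻¹)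
      (𝓝[>] 0 ×ˢ ⊤) (𝓝 (∫ _ : ℝ, (0 : ℝ))) := by
    refine tendsto_integral_filter_of_dominated_convergence (fun t => (2 * M) * (1 + t ^ 2)⁻¹)
      (.of_forall fun q => ?_) (.of_forall fun q => .of_forall fun t => ?_) (hint.const_mul _)
      (.of_forall fun t => ?_)
    · exact Continuous.aestronglyMeasurable (by fun_prop (disch := intros; positivity))
    · rw [norm_mul, norm_inv, Real.norm_of_nonneg (by positivity : 0 ≤ 1 + t ^ 2)]
      gcongr
      exact (norm_sub_le _ _).trans (by linarith [hM (q.2 + q.1 * t), hM q.2])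
    · suffices H : Tendsto (fun q : ℝ × ℝ => f (q.2 + q.1 * t) - f q.2) (𝓝[>] 0 ×ˢ ⊤) (𝓝 0) by
        simpa using H.mul_const ((1 + t ^ 2)⁻¹)
      rw [Metric.tendsto_nhds]
      intro η hη
      obtain ⟨κ, hκ, h⟩ := Metric.uniformContinuous_iff.1 huc η hη
      have h1 : Tendsto (fun q : ℝ × ℝ => q.1 * t) (𝓝[>] 0 ×ˢ ⊤) (𝓝 (0 * t)) :=
        ((tendsto_nhdsWithin_iff.1 tendsto_id).1.comp tendsto_fst).mul_const t
      rw [zero_mul, Metric.tendsto_nhds] at h1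
      filter_upwards [h1 κ hκ] with q hq
      rw [dist_zero_right, ← dist_eq_norm]
      exact h (by simpa [dist_eq_norm] using hq)
  rw [integral_zero, Metric.tendsto_nhds] at hlim
  have hev := hlim δ hδ
  rw [← principal_univ, eventually_prod_principal_iff] at hev
  obtain ⟨ε, h, hε⟩ := (hev.and self_mem_nhdsWithin).exists
  refine ⟨ε, hε, fun x => ?_⟩
  have hx := h x trivial
  have hi : Integrable fun t : ℝ => f (x + ε * t) * (1 + t ^ 2)⁻¹ := by
    refine hint.bdd_mul (c := M) (Continuous.aestronglyMeasurable (by fun_prop))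
      (.of_forall fun t => hM _)
  have hfx : f x = π⁻¹ * ∫ t, f x * (1 + t ^ 2)⁻¹ := by
    rw [integral_const_mul, integral_univ_inv_one_add_sq]
    field_simp
  rw [poissonSmoothing_eq f hε, hfx, ← mul_sub, ← integral_sub hi (hint.const_mul _),
    abs_mul, abs_of_pos (by positivity)]
  simp_rw [← sub_mul]
  rw [dist_zero_right, Real.norm_eq_abs] at hx
  calc π⁻¹ * _ ≤ 1 * δ := by
        gcongr
        exact inv_le_one_of_one_le₀ (by linarith [pi_gt_three])
    _ = δ := one_mul _

theorem integrable_inv_ofReal_sub (μ : Measure ℝ) [IsFiniteMeasure μ] {z : ℂ} (hz : 0 < z.im) :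
    Integrable (fun x : ℝ => ((x : ℂ) - z)⁻¹) μ :=
  .of_bound (measurable_inv_ofReal_sub z).aestronglyMeasurable _
    (.of_forall fun x => norm_inv_ofReal_sub_le x hz)

theorem integrable_mul_im_inv_prod {f : ℝ → ℝ} (hf : Continuous f) (hs : HasCompactSupport f)
    (μ : Measure ℝ) [IsFiniteMeasure μ] {ε : ℝ} (hε : 0 < ε) :
    Integrable (fun p : ℝ × ℝ => f p.2 * (((p.1 : ℂ) - (p.2 + ε * Complex.I))⁻¹).im)
      (μ.prod volume) := by
  have h1 : Integrable (fun p : ℝ × ℝ => f p.2) (μ.prod volume) := by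
    simpa using (integrable_const (1 : ℝ)).mul_prod (hf.integrable_of_hasCompactSupport hs)
  refine h1.mul_bdd (c := ε⁻¹) (Measurable.aestronglyMeasurable ?_) (.of_forall fun p => ?_)
  · exact Complex.measurable_im.comp (by fun_prop)
  · refine (Complex.abs_im_le_norm _).trans ?_
    simpa using norm_inv_ofReal_sub_le p.1 (z := p.2 + ε * Complex.I) (by simpa using hε)

theorem integral_poissonSmoothing {f : ℝ → ℝ} (hf : Continuous f) (hs : HasCompactSupport f)
    (μ : Measure ℝ) [IsFiniteMeasure μ] {ε : ℝ} (hε : 0 < ε) :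
    ∫ x, poissonSmoothing f ε x ∂μ
      = π⁻¹ * ∫ y, f y * (∫ x : ℝ, ((x : ℂ) - (y + ε * Complex.I))⁻¹ ∂μ).im := by
  simp_rw [poissonSmoothing]
  rw [integral_const_mul, integral_integral_swap (integrable_mul_im_inv_prod hf hs μ hε)]
  congr 2 with y
  rw [integral_const_mul]
  congr 1
  exact integral_im (integrable_inv_ofReal_sub μ (by simpa using hε))

theorem integrable_poissonSmoothing {f : ℝ → ℝ} (hf : Continuous f) (hs : HasCompactSupport f)
    (μ : Measure ℝ) [IsFiniteMeasure μ] {ε : ℝ} (hε : 0 < ε) :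
    Integrable (poissonSmoothing f ε) μ :=
  (integrable_mul_im_inv_prod hf hs μ hε).integral_prod_left.const_mul _

theorem abs_integral_poissonSmoothing_sub_le {f : ℝ → ℝ} (hf : Continuous f)
    (hs : HasCompactSupport f) (μ : Measure ℝ) [IsFiniteMeasure μ] {ε δ C : ℝ} (hε : 0 < ε)
    (hδ : 0 ≤ δ) (h : ∀ x, |poissonSmoothing f ε x - f x| ≤ δ) (hC : μ.real Set.univ ≤ C) :
    |∫ x, poissonSmoothing f ε x ∂μ - ∫ x, f x ∂μ| ≤ δ * C := by
  obtain ⟨M, hM⟩ := hs.exists_bound_of_continuous hf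
  rw [← integral_sub (integrable_poissonSmoothing hf hs μ hε)
    (.of_bound hf.aestronglyMeasurable M (.of_forall hM))]
  rw [← Real.norm_eq_abs]
  refine (norm_integral_le_of_norm_le_const (C := δ) (.of_forall h)).trans ?_
  gcongr

/-- Pointwise convergence of Stieltjes transforms of measures of bounded mass implies vague
convergence. -/
theorem tendsto_integral_of_tendsto_stieltjes {μs : ℕ → Measure ℝ} {μ : Measure ℝ}
    [∀ n, IsFiniteMeasure (μs n)] [IsFiniteMeasure μ] {C : ℝ}
    (hC : ∀ n, (μs n).real Set.univ ≤ C) (hCμ : μ.real Set.univ ≤ C)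
    (h : ∀ z : ℂ, 0 < z.im → Tendsto (fun n => ∫ x : ℝ, ((x : ℂ) - z)⁻¹ ∂μs n) atTop
      (𝓝 (∫ x : ℝ, ((x : ℂ) - z)⁻¹ ∂μ)))
    {f : ℝ → ℝ} (hf : Continuous f) (hs : HasCompactSupport f) :
    Tendsto (fun n => ∫ x, f x ∂μs n) atTop (𝓝 (∫ x, f x ∂μ)) := by
  have hC0 : 0 ≤ C := measureReal_nonneg.trans hCμ
  have hsm : ∀ ε > 0, Tendsto (fun n => ∫ x, poissonSmoothing f ε x ∂μs n) atTop
      (𝓝 (∫ x, poissonSmoothing f ε x ∂μ)) := by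
    intro ε hε
    simp_rw [integral_poissonSmoothing hf hs _ hε]
    refine Tendsto.const_mul _ ?_
    have him : ∀ y : ℝ, 0 < ((y : ℂ) + ε * Complex.I).im := fun y => by simpa using hε
    refine tendsto_integral_of_dominated_convergence (fun y => |f y| * (ε⁻¹ * C)) (fun n => ?_)
      ((hf.integrable_of_hasCompactSupport hs).abs.mul_const _) (fun n => .of_forall fun y => ?_)
      (.of_forall fun y => ?_)
    · refine hf.aestronglyMeasurable.mul (Complex.continuous_im.comp_aestronglyMeasurable ?_)
      refine StronglyMeasurable.aestronglyMeasurable ?_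
      refine StronglyMeasurable.integral_prod_right
        (f := fun y x : ℝ => ((x : ℂ) - (y + ε * Complex.I))⁻¹) ?_
      exact Measurable.stronglyMeasurable (by unfold Function.uncurry; fun_prop)
    · rw [norm_mul, Real.norm_eq_abs]
      gcongr
      refine (Complex.abs_im_le_norm _).trans ?_
      refine (norm_integral_le_of_norm_le_const (C := ε⁻¹) (.of_forall fun x => ?_)).trans ?_
      · simpa using norm_inv_ofReal_sub_le x (him y)
      · gcongr
        exact hC n
    · exact ((Complex.continuous_im.tendsto _).comp (h _ (him y))).const_mul _
  rw [Metric.tendsto_atTop]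
  intro η hη
  have hδ : 0 < η / (3 * (C + 1)) := by positivity
  obtain ⟨ε, hε, hclose⟩ := exists_poissonSmoothing_close hf hs hδ
  have hδC : η / (3 * (C + 1)) * C ≤ η / 3 := by
    rw [div_mul_eq_mul_div, div_le_div_iff₀ (by positivity) (by norm_num)]
    nlinarith
  obtain ⟨N, hN⟩ := Metric.tendsto_atTop.1 (hsm ε hε) (η / 3) (by positivity)
  refine ⟨N, fun n hn => ?_⟩
  have h1 := abs_integral_poissonSmoothing_sub_le hf hs (μs n) hε hδ.le hclose (hC n)
  have h2 := abs_integral_poissonSmoothing_sub_le hf hs μ hε hδ.le hclose hCμ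
  have h3 := hN n hn
  rw [Real.dist_eq] at h3 ⊢
  rw [abs_le] at h1 h2
  rw [abs_lt] at h3 ⊢
  constructor <;> linarith

namespace Matrix.IsHermitian

variable {n : Type*} [Fintype n] {A : Matrix n n ℂ}

theorem im_sq_mul_sum_norm_sq_le (hA : A.IsHermitian) (z : ℂ) (x : n → ℂ) :
    z.im ^ 2 * ∑ i, ‖x i‖ ^ 2 ≤ ∑ i, ‖(A *ᵥ x) i - z * x i‖ ^ 2 := by
  set v : EuclideanSpace ℂ n := WithLp.toLp 2 x
  set w : EuclideanSpace ℂ n := WithLp.toLp 2 (A *ᵥ x - z • x)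
  have hv : ∑ i, ‖x i‖ ^ 2 = ‖v‖ ^ 2 := (EuclideanSpace.norm_sq_eq v).symm
  have hw : ∑ i, ‖(A *ᵥ x) i - z * x i‖ ^ 2 = ‖w‖ ^ 2 := (EuclideanSpace.norm_sq_eq w).symm
  rw [hv, hw]
  have hin : (inner ℂ v w).im = -z.im * ‖v‖ ^ 2 := by
    have h1 : w = WithLp.toLp 2 (A *ᵥ x) - z • v := rfl
    have h2 : (inner ℂ v (WithLp.toLp 2 (A *ᵥ x))).im = 0 := by
      have := hA.im_star_dotProduct_mulVec_self x
      rw [EuclideanSpace.inner_eq_star_dotProduct, dotProduct_comm]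
      exact this
    rw [h1, inner_sub_right, inner_smul_right, inner_self_eq_norm_sq_to_K, Complex.sub_im, h2]
    norm_cast
    simp [Complex.mul_im, sq]
  have hle : |z.im| * ‖v‖ ^ 2 ≤ ‖v‖ * ‖w‖ := by
    calc |z.im| * ‖v‖ ^ 2 = |(inner ℂ v w).im| := by
          rw [hin, abs_mul, abs_neg, abs_of_nonneg (sq_nonneg ‖v‖)]
      _ ≤ ‖inner ℂ v w‖ := Complex.abs_im_le_norm _
      _ ≤ ‖v‖ * ‖w‖ := norm_inner_le_norm v w
  rcases (norm_nonneg v).eq_or_lt with h0 | h0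
  · rw [← h0]; simp
  · have : |z.im| * ‖v‖ ≤ ‖w‖ := by
      rw [sq, ← mul_assoc, mul_comm] at hle
      exact le_of_mul_le_mul_left hle h0
    rw [← sq_abs z.im, ← mul_pow]
    gcongr

variable [DecidableEq n]

/-- The resolvent of a Hermitian matrix, given by its spectral decomposition. -/
noncomputable def resolvent (hA : A.IsHermitian) (z : ℂ) : Matrix n n ℂ :=
  Unitary.conjStarAlgAut ℂ _ hA.eigenvectorUnitary
    (diagonal fun k => ((hA.eigenvalues k : ℂ) - z)⁻¹)

theorem trace_resolvent (hA : A.IsHermitian) (z : ℂ) :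
    (hA.resolvent z).trace = ∑ k, ((hA.eigenvalues k : ℂ) - z)⁻¹ := by
  rw [resolvent, Unitary.conjStarAlgAut_apply, trace_mul_comm, ← mul_assoc]
  simp

theorem sub_smul_mul_resolvent (hA : A.IsHermitian) {z : ℂ} (hz : z.im ≠ 0) :
    (A - z • 1) * hA.resolvent z = 1 := by
  have h : A - z • 1 = Unitary.conjStarAlgAut ℂ _ hA.eigenvectorUnitary
      (diagonal fun k => (hA.eigenvalues k : ℂ) - z) := by
    have hd : (diagonal fun k => (hA.eigenvalues k : ℂ) - z)
        = diagonal (RCLike.ofReal ∘ hA.eigenvalues) - z • (1 : Matrix n n ℂ) := by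
      rw [smul_one_eq_diagonal, diagonal_sub]
      rfl
    rw [hd, map_sub, map_smul, map_one, ← hA.spectral_theorem]
  have hne : ∀ k, (hA.eigenvalues k : ℂ) - z ≠ 0 := fun k h0 => hz <| by
    simpa using congrArg Complex.im h0
  rw [h, resolvent, ← map_mul, diagonal_mul_diagonal]
  simp [hne]

theorem im_sq_mul_norm_resolvent_sub_sq_le (hA : A.IsHermitian) {z : ℂ} (hz : z.im ≠ 0) (j : n)
    (w : n → ℂ) : z.im ^ 2 * ‖hA.resolvent z j j - w j‖ ^ 2 ≤
      ∑ i, ‖(A *ᵥ w) i - z * w i - (Pi.single j 1 : n → ℂ) i‖ ^ 2 := by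
  set u : n → ℂ := fun i => hA.resolvent z i j
  have hu : ∀ i, (A *ᵥ u) i - z * u i = (Pi.single j 1 : n → ℂ) i := by
    intro i
    have := congrFun (congrFun (hA.sub_smul_mul_resolvent hz) i) j
    rw [sub_mul, smul_mul_assoc, one_mul, sub_apply, smul_apply, mul_apply, one_apply] at this
    rw [Pi.single_apply]
    exact this
  calc z.im ^ 2 * ‖hA.resolvent z j j - w j‖ ^ 2
      ≤ z.im ^ 2 * ∑ i, ‖(w - u) i‖ ^ 2 := by
        gcongr
        rw [norm_sub_rev]
        exact single_le_sum (f := fun i => ‖(w - u) i‖ ^ 2) (fun i _ => by positivity) (mem_univ j)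
    _ ≤ _ := hA.im_sq_mul_sum_norm_sq_le z _
    _ = _ := by
        refine sum_congr rfl fun i _ => ?_
        rw [← hu i, mulVec_sub, Pi.sub_apply, Pi.sub_apply]
        ring_nf

theorem norm_resolvent_apply_self_le (hA : A.IsHermitian) {z : ℂ} (hz : 0 < z.im) (j : n) :
    ‖hA.resolvent z j j‖ ≤ z.im⁻¹ := by
  have h := hA.im_sq_mul_norm_resolvent_sub_sq_le hz.ne' j 0
  have h1 : ∑ i, ‖(Pi.single j 1 : n → ℂ) i‖ ^ 2 = 1 := by
    rw [sum_eq_single j] <;> simp +contextual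
  simp only [mulVec_zero, Pi.zero_apply, mul_zero, sub_zero, zero_sub, norm_neg, h1,
    ← mul_pow] at h
  rw [sq_le_one_iff₀ (by positivity)] at h
  rwa [← one_div, le_div_iff₀' hz]

end Matrix.IsHermitian

theorem sum_range_eq_integral_floor (F : ℕ → ℂ) (N : ℕ) :
    ∑ j ∈ range N, F j = ∫ x in (0 : ℝ)..N, F ⌊x⌋₊ := by
  have key : ∀ k : ℕ, Set.EqOn (fun x : ℝ => F ⌊x⌋₊) (fun _ => F k) (Set.Ico (k : ℝ) (k + 1)) := by
    intro k x hx
    simp [Nat.floor_eq_on_Ico k x hx]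
  have hae : ∀ k : ℕ, ∀ᵐ x : ℝ, x ∈ Set.uIoc (k : ℝ) ((k + 1 : ℕ) : ℝ) → F k = F ⌊x⌋₊ := by
    intro k
    filter_upwards [Measure.ae_ne volume ((k : ℝ) + 1)] with x hne hx
    rw [Set.uIoc_of_le (by simp)] at hx
    push_cast at hx
    exact (key k ⟨hx.1.le, lt_of_le_of_ne hx.2 hne⟩).symm
  have h := intervalIntegral.sum_integral_adjacent_intervals (f := fun x : ℝ => F ⌊x⌋₊)
    (μ := volume) (a := fun k : ℕ => (k : ℝ)) (n := N) fun k _ =>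
      (intervalIntegrable_const (c := F k)).congr_ae
        ((ae_restrict_iff' measurableSet_uIoc).2 (hae k))
  simp only [Nat.cast_zero] at h
  rw [← h]
  refine sum_congr rfl fun k _ => ?_
  rw [← intervalIntegral.integral_congr_ae (hae k)]
  simp

theorem tendsto_average_of_tendsto_floor {F : ℕ → ℕ → ℂ} {G : ℝ → ℂ} {C : ℝ}
    (hC : ∀ n j, ‖F n j‖ ≤ C)
    (h : ∀ x ∈ Set.Ioo (0 : ℝ) 1, Tendsto (fun n : ℕ => F n ⌊x * (n + 1)⌋₊) atTop (𝓝 (G x))) :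
    Tendsto (fun n : ℕ => ((n : ℂ) + 1)⁻¹ * ∑ j ∈ range (n + 1), F n j) atTop
      (𝓝 (∫ x in (0 : ℝ)..1, G x)) := by
  have heq : ∀ n : ℕ, ((n : ℂ) + 1)⁻¹ * ∑ j ∈ range (n + 1), F n j
      = ∫ x in (0 : ℝ)..1, F n ⌊x * (n + 1)⌋₊ := by
    intro n
    have hn : ((n : ℝ) + 1) ≠ 0 := by positivity
    rw [sum_range_eq_integral_floor,
      intervalIntegral.integral_comp_mul_right (fun x => F n ⌊x⌋₊) hn]
    simp [Complex.real_smul]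
  simp_rw [heq]
  refine intervalIntegral.tendsto_integral_filter_of_dominated_convergence (fun _ => C)
    (.of_forall fun n => ?_) (.of_forall fun n => .of_forall fun x _ => hC _ _)
    intervalIntegrable_const ?_
  · refine Measurable.aestronglyMeasurable ?_
    exact (measurable_from_top (f := F n)).comp (Nat.measurable_floor.comp (by fun_prop))
  · filter_upwards [Measure.ae_ne volume (1 : ℝ)] with x hne hx
    rw [Set.uIoc_of_le zero_le_one] at hx
    exact h x ⟨hx.1, lt_of_le_of_ne hx.2 hne⟩

section AddCircle

variable {T : ℝ} [hT : Fact (0 < T)]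

theorem integrable_haarAddCircle (f : C(AddCircle T, ℂ)) :
    Integrable f AddCircle.haarAddCircle :=
  f.continuous.integrable_of_hasCompactSupport (HasCompactSupport.of_compactSpace f)

/-- The `t`-th Fourier coefficient as a linear functional on continuous functions. -/
noncomputable def fourierCoeffLinear (t : ℤ) : C(AddCircle T, ℂ) →ₗ[ℂ] ℂ where
  toFun f := fourierCoeff f t
  map_add' f g := congrFun
    (fourierCoeff.add (integrable_haarAddCircle f) (integrable_haarAddCircle g)) t
  map_smul' c f := fourierCoeff.const_smul f c t

theorem fourierCoeffLinear_mul_fourier (f : C(AddCircle T, ℂ)) (s t : ℤ) :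
    fourierCoeffLinear t (f * fourier s) = fourierCoeff f (t - s) := by
  change fourierCoeff (fun x => f x * fourier s x) t = _
  rw [fourierCoeff, fourierCoeff]
  congr 1 with x
  rw [neg_sub, sub_eq_neg_add, fourier_add, smul_eq_mul, smul_eq_mul]
  ring

theorem fourierCoeffLinear_fourier (s t : ℤ) :
    fourierCoeffLinear t (fourier s : C(AddCircle T, ℂ)) = (Pi.single s 1 : ℤ → ℂ) t :=
  congrFun (fourierCoeff_fourier s) t

theorem hasSum_sq_fourierCoeffLinear (f : C(AddCircle T, ℂ)) :
    HasSum (fun t => ‖fourierCoeffLinear t f‖ ^ 2)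
      (∫ x, ‖f x‖ ^ 2 ∂AddCircle.haarAddCircle) := by
  have h := hasSum_sq_fourierCoeff (ContinuousMap.toLp 2 AddCircle.haarAddCircle ℂ f)
  simp only [fourierCoeff_toLp] at h
  rw [integral_congr_ae (g := fun x => ‖f x‖ ^ 2)] at h
  · exact h
  · filter_upwards [ContinuousMap.coeFn_toLp AddCircle.haarAddCircle (𝕜 := ℂ) (p := 2) f] with x hx
    rw [hx]

theorem tsum_sq_fourierCoeffLinear_le (f : C(AddCircle T, ℂ)) {δ : ℝ} (hf : ‖f‖ ≤ δ) :
    ∑' t, ‖fourierCoeffLinear t f‖ ^ 2 ≤ δ ^ 2 := by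
  rw [(hasSum_sq_fourierCoeffLinear f).tsum_eq]
  have h : ‖∫ x, ‖f x‖ ^ 2 ∂(AddCircle.haarAddCircle (T := T))‖ ≤
      δ ^ 2 * (AddCircle.haarAddCircle (T := T)).real Set.univ := by
    refine norm_integral_le_of_norm_le_const (.of_forall fun x => ?_)
    rw [norm_pow, norm_norm]
    gcongr
    exact (f.norm_coe_le_norm x).trans hf
  simpa using (le_abs_self _).trans h

/-- Finitely supported approximate solutions of the resolvent equation for the Laurent operator
with real symbol `τ`. -/
theorem exists_finsupp_approx_resolvent (τ : C(AddCircle T, ℂ)) (hτ : ∀ x, (τ x).im = 0) {z : ℂ}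
    (hz : 0 < z.im) {ε : ℝ} (hε : 0 < ε) :
    ∃ w : ℤ →₀ ℂ,
      ∑' t, ‖(w.sum fun s a => fourierCoeff τ (t - s) * a) - z * w t
          - (Pi.single 0 1 : ℤ → ℂ) t‖ ^ 2 ≤ ε ^ 2 ∧
      ‖w 0 - ∫ x, (τ x - z)⁻¹ ∂AddCircle.haarAddCircle‖ ≤ ε := by
  have hne : ∀ x, τ x - z ≠ 0 := fun x h => hz.ne' <| by
    simpa [hτ x] using congrArg Complex.im h
  let g : C(AddCircle T, ℂ) := ⟨fun x => (τ x - z)⁻¹, by fun_prop (disch := exact hne)⟩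
  let c : C(AddCircle T, ℂ) := τ - algebraMap ℂ _ z
  have hcg : c * g = 1 := by
    ext x
    exact mul_inv_cancel₀ (hne x)
  set δ : ℝ := ε / (‖c‖ + 1)
  have hδ : 0 < δ := by positivity
  have hg : g ∈ (Submodule.span ℂ (Set.range (fourier (T := T)))).topologicalClosure := by
    rw [span_fourier_closure_eq_top]
    trivial
  obtain ⟨P, hP, hPg⟩ := Metric.mem_closure_iff.1 hg δ hδ
  obtain ⟨w, rfl⟩ := Finsupp.mem_span_range_iff_exists_finsupp.1 hP
  set P : C(AddCircle T, ℂ) := w.sum fun i a => a • fourier i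
  rw [dist_comm, dist_eq_norm] at hPg
  have hδc : ‖c‖ * δ ≤ ε := by
    rw [mul_div_assoc', div_le_iff₀ (by positivity)]
    nlinarith
  have hδε : δ ≤ ε := div_le_self hε.le (by linarith [norm_nonneg c])
  have hcoef : ∀ t, fourierCoeffLinear t P = w t := by
    intro t
    simp only [P, Finsupp.sum, map_sum, map_smul, fourierCoeffLinear_fourier, smul_eq_mul]
    simp [Pi.single_apply, eq_comm]
  refine ⟨w, ?_, ?_⟩
  · have hE : ∀ t, (w.sum fun s a => fourierCoeff τ (t - s) * a) - z * w t
        - (Pi.single 0 1 : ℤ → ℂ) t = fourierCoeffLinear t (c * (P - g)) := by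
      intro t
      have h0 : (1 : C(AddCircle T, ℂ)) = fourier 0 := by
        ext x
        simp
      have h1 : c * (P - g) = (w.sum fun s a => a • (τ * fourier s)) - z • P - fourier 0 := by
        rw [mul_sub, hcg, h0, sub_mul, ← Algebra.smul_def]
        congr 2
        simp only [P, Finsupp.sum, mul_sum, mul_smul_comm]
      rw [h1, map_sub, map_sub, map_smul, hcoef, fourierCoeffLinear_fourier]
      simp only [Finsupp.sum, map_sum, map_smul, fourierCoeffLinear_mul_fourier, smul_eq_mul,
        mul_comm]
    simp_rw [hE]
    refine tsum_sq_fourierCoeffLinear_le _ ((norm_mul_le _ _).trans (le_trans ?_ hδc))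
    gcongr
  · have h0 : w 0 = ∫ x, P x ∂AddCircle.haarAddCircle := by
      rw [← hcoef 0]
      change fourierCoeff P 0 = _
      simp [fourierCoeff]
    rw [h0]
    change ‖_ - ∫ x, g x ∂AddCircle.haarAddCircle‖ ≤ ε
    rw [← integral_sub (integrable_haarAddCircle P) (integrable_haarAddCircle g)]
    refine (norm_integral_le_of_norm_le_const (C := δ) (.of_forall fun x => ?_)).trans
      (by simpa using hδε)
    exact ((P - g).norm_coe_le_norm x).trans hPg.le

end AddCircle

/-- The rescaled frequency `(2i - ℓ + 2) / ℓ`. -/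
noncomputable def scaledFreq (ℓ : ℕ) (i : ℤ) : ℝ := ((2 * i - (ℓ : ℤ) + 2 : ℤ) : ℝ) / (ℓ : ℝ)

/-- The weight `(1 - ξ²)^(-1/4)` at the `i`-th rescaled frequency, extended by zero. -/
noncomputable def freqWeight (ℓ : ℕ) (i : ℤ) : ℝ :=
  if 0 ≤ i ∧ i < (ℓ : ℤ) - 1 then (1 - scaledFreq ℓ i ^ 2) ^ (-(1 / 4) : ℝ) else 0

theorem mem_range_of_abs_scaledFreq_lt_one {ℓ : ℕ} (hℓ : 0 < ℓ) {i : ℤ}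
    (h : |scaledFreq ℓ i| < 1) : 0 ≤ i ∧ i < (ℓ : ℤ) - 1 := by
  have hℓ' : (0 : ℝ) < ℓ := by exact_mod_cast hℓ
  rw [scaledFreq, abs_div, abs_of_pos hℓ', div_lt_one hℓ', abs_lt] at h
  obtain ⟨h1, h2⟩ := h
  have h1 : -(ℓ : ℤ) < 2 * i - (ℓ : ℤ) + 2 := by exact_mod_cast h1
  have h2 : 2 * i - (ℓ : ℤ) + 2 < (ℓ : ℤ) := by exact_mod_cast h2
  omega

theorem freqWeight_nonneg (ℓ : ℕ) (i : ℤ) : 0 ≤ freqWeight ℓ i := by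
  rw [freqWeight]
  split_ifs with h
  · refine rpow_nonneg ?_ _
    have hℓ : (0 : ℝ) < ℓ := by
      have : 0 < ℓ := by omega
      exact_mod_cast this
    rw [sub_nonneg, sq_le_one_iff_abs_le_one, scaledFreq, abs_div, abs_of_pos hℓ, div_le_one hℓ,
      abs_le]
    constructor
    · have : -(ℓ : ℤ) ≤ 2 * i - (ℓ : ℤ) + 2 := by omega
      exact_mod_cast this
    · have : 2 * i - (ℓ : ℤ) + 2 ≤ (ℓ : ℤ) := by omega
      exact_mod_cast this
  · exact le_rfl

theorem le_one_sub_scaledFreq_sq {ℓ : ℕ} {j t : ℤ} {κ : ℝ} (hκ : 0 < κ)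
    (hj : |scaledFreq ℓ j| ≤ 1 - κ) (h : 0 ≤ j + t ∧ j + t < (ℓ : ℤ) - 1) :
    κ / 2 / (1 + |(t : ℝ)|) ≤ 1 - scaledFreq ℓ (j + t) ^ 2 := by
  have hℓ : (0 : ℝ) < ℓ := by
    have : 0 < ℓ := by omega
    exact_mod_cast this
  set ξ := scaledFreq ℓ (j + t)
  have hξt : ξ = scaledFreq ℓ j + 2 * t / ℓ := by
    simp only [ξ, scaledFreq]
    push_cast
    ring
  have hle2 : |ξ| ≤ 1 - 2 / ℓ := by
    have h1 : -((ℓ : ℤ) : ℝ) + 2 ≤ ((2 * (j + t) - (ℓ : ℤ) + 2 : ℤ) : ℝ) := by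
      have : -(ℓ : ℤ) + 2 ≤ 2 * (j + t) - (ℓ : ℤ) + 2 := by omega
      exact_mod_cast this
    have h2 : ((2 * (j + t) - (ℓ : ℤ) + 2 : ℤ) : ℝ) ≤ ((ℓ : ℤ) : ℝ) - 2 := by
      have : 2 * (j + t) - (ℓ : ℤ) + 2 ≤ (ℓ : ℤ) - 2 := by omega
      exact_mod_cast this
    rw [Int.cast_natCast] at h1 h2
    rw [show |ξ| = _ from abs_div _ _, abs_of_pos hℓ, one_sub_div hℓ.ne',
      div_le_div_iff_of_pos_right hℓ, abs_le]
    constructor <;> linarith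
  have hle1 : |ξ| ≤ 1 - κ + 2 * |(t : ℝ)| / ℓ := by
    rw [hξt]
    refine (abs_add_le _ _).trans (add_le_add hj ?_)
    rw [abs_div, abs_mul, abs_of_pos hℓ, abs_two]
  have hone : 1 - |ξ| ≤ 1 - ξ ^ 2 := by
    have : |ξ| ≤ 1 := hle2.trans (by linarith [div_pos two_pos hℓ])
    rw [← sq_abs]
    nlinarith [abs_nonneg ξ]
  refine le_trans ?_ hone
  have ht := abs_nonneg (t : ℝ)
  rw [div_le_iff₀ (by positivity)]
  rcases le_or_gt (2 * |(t : ℝ)| / ℓ) (κ / 2) with hc | hc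
  · nlinarith
  · rw [lt_div_iff₀ hℓ] at hc
    have h2 : 2 / (ℓ : ℝ) ≤ 1 - |ξ| := by linarith
    calc κ / 2 = 2 / (ℓ : ℝ) * (κ / 2 * ℓ / 2) := by field_simp
      _ ≤ (1 - |ξ|) * (1 + |(t : ℝ)|) := by
        gcongr
        · linarith [div_pos two_pos hℓ]
        · linarith

theorem freqWeight_add_le {ℓ : ℕ} {j : ℤ} {κ : ℝ} (hκ : 0 < κ) (hj : |scaledFreq ℓ j| ≤ 1 - κ)
    (t : ℤ) :
    freqWeight ℓ (j + t) ≤ (κ / 2) ^ (-(1 / 4) : ℝ) * (1 + |(t : ℝ)|) ^ (1 / 4 : ℝ) := by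
  rw [freqWeight]
  split_ifs with h
  · refine (rpow_le_rpow_of_nonpos (by positivity) (le_one_sub_scaledFreq_sq hκ hj h)
      (by norm_num)).trans_eq ?_
    rw [div_rpow (by positivity) (by positivity), rpow_neg (by positivity : 0 ≤ 1 + |(t : ℝ)|),
      div_inv_eq_mul]
  · positivity

theorem tendsto_scaledFreq_add {j : ℕ → ℤ} {ξ : ℝ}
    (hj : Tendsto (fun n => scaledFreq n (j n)) atTop (𝓝 ξ)) (t : ℤ) :
    Tendsto (fun n => scaledFreq n (j n + t)) atTop (𝓝 ξ) := by
  have h : ∀ n, scaledFreq n (j n + t) = scaledFreq n (j n) + (2 * t : ℝ) / n := by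
    intro n
    simp only [scaledFreq]
    push_cast
    ring
  simp_rw [h]
  simpa using hj.add (tendsto_const_div_atTop_nhds_zero_nat (2 * t : ℝ))

theorem tendsto_freqWeight_add {j : ℕ → ℤ} {ξ : ℝ} (hξ : |ξ| < 1)
    (hj : Tendsto (fun n => scaledFreq n (j n)) atTop (𝓝 ξ)) (t : ℤ) :
    Tendsto (fun n => freqWeight n (j n + t)) atTop (𝓝 ((1 - ξ ^ 2) ^ (-(1 / 4) : ℝ))) := by
  have h := tendsto_scaledFreq_add hj t
  have hpos : 1 - ξ ^ 2 ≠ 0 := by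
    have := (sq_lt_one_iff_abs_lt_one ξ).2 hξ
    linarith
  refine ((tendsto_const_nhds.sub (h.pow 2)).rpow_const (Or.inl hpos)).congr' ?_
  filter_upwards [h.abs.eventually_lt_const hξ, eventually_gt_atTop 0] with n hn hn0
  rw [freqWeight, if_pos (mem_range_of_abs_scaledFreq_lt_one hn0 hn)]

theorem summable_one_add_abs_int_rpow {b : ℝ} (hb : 1 < b) :
    Summable fun t : ℤ => (1 + |(t : ℝ)|) ^ (-b) := by
  refine Summable.of_norm_bounded_eventually (Real.summable_abs_int_rpow hb) ?_
  filter_upwards [(Set.finite_singleton (0 : ℤ)).compl_mem_cofinite] with t ht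
  have ht : 0 < |(t : ℝ)| := by simpa using ht
  rw [norm_of_nonneg (by positivity)]
  exact rpow_le_rpow_of_nonpos ht (by linarith) (by linarith)

/-- The residual at offset `t` of the resolvent equation at spectral parameter `z` for the weighted
Toeplitz matrix with coefficients `c`, tested on a vector `w` centred at `j`. -/
noncomputable def localResidual (c : ℤ → ℂ) (w : ℤ →₀ ℂ) (z : ℂ) (ℓ : ℕ) (j t : ℤ) : ℂ :=
  (w.sum fun s a => ((4 / π * freqWeight ℓ (j + t) * freqWeight ℓ (j + s) : ℝ) : ℂ) * c (t - s) * a)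
    - z * w t - (Pi.single 0 1 : ℤ → ℂ) t

theorem exists_localResidual_bound {c : ℤ → ℂ} {C : ℝ} (hC : 0 ≤ C)
    (hc : ∀ s, ‖c s‖ ≤ C / (1 + |(s : ℝ)|)) (w : ℤ →₀ ℂ) (z : ℂ) {κ : ℝ} (hκ : 0 < κ) :
    ∃ M : ℝ, ∀ ℓ : ℕ, ∀ j : ℤ, |scaledFreq ℓ j| ≤ 1 - κ → ∀ t, ‖localResidual c w z ℓ j t‖ ≤
      M * (1 + |(t : ℝ)|) ^ (-(3 / 4) : ℝ) + ‖z * w t + (Pi.single 0 1 : ℤ → ℂ) t‖ := by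
  set K : ℝ := (κ / 2) ^ (-(1 / 4) : ℝ)
  refine ⟨w.sum fun s a => 4 / π * K * (K * (1 + |(s : ℝ)|) ^ (1 / 4 : ℝ)) * (C * (1 + |(s : ℝ)|))
    * ‖a‖, fun ℓ j hj t => ?_⟩
  rw [localResidual, sub_sub]
  refine (norm_sub_le _ _).trans (add_le_add_left ?_ _)
  rw [Finsupp.sum, Finsupp.sum, sum_mul]
  refine norm_sum_le_of_le _ fun s _ => ?_
  have hts : C / (1 + |((t - s : ℤ) : ℝ)|) ≤ C * (1 + |(s : ℝ)|) / (1 + |(t : ℝ)|) := by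
    rw [div_le_div_iff₀ (by positivity) (by positivity), mul_assoc]
    gcongr
    have h1 : |(t : ℝ)| ≤ |((t - s : ℤ) : ℝ)| + |(s : ℝ)| := by
      simpa using abs_add_le ((t - s : ℤ) : ℝ) (s : ℝ)
    nlinarith [abs_nonneg (s : ℝ), abs_nonneg ((t - s : ℤ) : ℝ)]
  have hpow : (1 + |(t : ℝ)|) ^ (-(3 / 4) : ℝ)
      = (1 + |(t : ℝ)|) ^ (1 / 4 : ℝ) / (1 + |(t : ℝ)|) := by
    rw [← rpow_sub_one (by positivity)]
    norm_num
  have h0 := freqWeight_nonneg ℓ (j + t)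
  have h1 := freqWeight_nonneg ℓ (j + s)
  rw [norm_mul, norm_mul, Complex.norm_real, norm_of_nonneg (by positivity)]
  calc 4 / π * freqWeight ℓ (j + t) * freqWeight ℓ (j + s) * ‖c (t - s)‖ * ‖w s‖
      ≤ 4 / π * (K * (1 + |(t : ℝ)|) ^ (1 / 4 : ℝ)) * (K * (1 + |(s : ℝ)|) ^ (1 / 4 : ℝ))
        * (C * (1 + |(s : ℝ)|) / (1 + |(t : ℝ)|)) * ‖w s‖ := by
        gcongr
        · exact freqWeight_add_le hκ hj t
        · exact freqWeight_add_le hκ hj s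
        · exact (hc _).trans hts
    _ = _ := by
        rw [hpow]
        ring

theorem summable_residual_bound (M : ℝ) (w : ℤ →₀ ℂ) (z : ℂ) :
    Summable fun t : ℤ => (M * (1 + |(t : ℝ)|) ^ (-(3 / 4) : ℝ)
      + ‖z * w t + (Pi.single 0 1 : ℤ → ℂ) t‖) ^ 2 := by
  have h1 : Summable fun t : ℤ => 2 * M ^ 2 * (1 + |(t : ℝ)|) ^ (-(3 / 2) : ℝ) :=
    (summable_one_add_abs_int_rpow (by norm_num)).mul_left _
  have h2 : Summable fun t : ℤ => 2 * ‖z * w t + (Pi.single 0 1 : ℤ → ℂ) t‖ ^ 2 := by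
    refine summable_of_ne_finset_zero (s := insert 0 w.support) fun t ht => ?_
    rw [mem_insert, Finsupp.mem_support_iff, not_or, not_not] at ht
    simp [ht.1, ht.2]
  refine Summable.of_nonneg_of_le (fun t => by positivity) (fun t => ?_) (h1.add h2)
  have hpow : (1 + |(t : ℝ)|) ^ (-(3 / 2) : ℝ) = ((1 + |(t : ℝ)|) ^ (-(3 / 4) : ℝ)) ^ 2 := by
    rw [← rpow_mul_natCast (by positivity)]
    norm_num
  rw [hpow]
  nlinarith [sq_nonneg (M * (1 + |(t : ℝ)|) ^ (-(3 / 4) : ℝ)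
    - ‖z * w t + (Pi.single 0 1 : ℤ → ℂ) t‖)]

theorem tendsto_tsum_localResidual {c : ℤ → ℂ} {C : ℝ} (hC : 0 ≤ C)
    (hc : ∀ s, ‖c s‖ ≤ C / (1 + |(s : ℝ)|)) (w : ℤ →₀ ℂ) (z : ℂ) {j : ℕ → ℤ} {ξ : ℝ} (hξ : |ξ| < 1)
    (hj : Tendsto (fun n => scaledFreq n (j n)) atTop (𝓝 ξ)) :
    (∀ᶠ n in atTop, Summable fun t => ‖localResidual c w z n (j n) t‖ ^ 2) ∧
    Tendsto (fun n => ∑' t, ‖localResidual c w z n (j n) t‖ ^ 2) atTop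
      (𝓝 (∑' t, ‖(w.sum fun s a => ((4 / (π * √(1 - ξ ^ 2)) : ℝ) : ℂ) * c (t - s) * a)
        - z * w t - (Pi.single 0 1 : ℤ → ℂ) t‖ ^ 2)) := by
  have hκ : 0 < (1 - |ξ|) / 2 := by linarith
  obtain ⟨M, hM⟩ := exists_localResidual_bound hC hc w z hκ
  have hev : ∀ᶠ n in atTop, ∀ t, ‖‖localResidual c w z n (j n) t‖ ^ 2‖ ≤
      (M * (1 + |(t : ℝ)|) ^ (-(3 / 4) : ℝ) + ‖z * w t + (Pi.single 0 1 : ℤ → ℂ) t‖) ^ 2 := by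
    filter_upwards [hj.abs.eventually_lt_const (by linarith : |ξ| < 1 - (1 - |ξ|) / 2)]
      with n hn t
    rw [norm_pow, norm_norm]
    gcongr
    exact hM n (j n) hn.le t
  refine ⟨?_, tendsto_tsum_of_dominated_convergence (summable_residual_bound M w z)
    (fun t => ?_) hev⟩
  · filter_upwards [hev] with n hn
    exact .of_norm_bounded (summable_residual_bound M w z) hn
  · refine (Tendsto.norm ?_).pow 2
    refine (Tendsto.sub_const ?_ _).sub_const _
    refine tendsto_finsetSum _ fun s _ => ?_
    refine (Tendsto.mul_const _ ?_).mul_const _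
    refine (Complex.continuous_ofReal.tendsto _).comp ?_
    have hpos : 0 < 1 - ξ ^ 2 := by
      have := (sq_lt_one_iff_abs_lt_one ξ).2 hξ
      linarith
    have h := ((tendsto_freqWeight_add hξ hj t).const_mul (4 / π)).mul
      (tendsto_freqWeight_add hξ hj s)
    convert h using 2
    rw [mul_assoc, ← rpow_add hpos, sqrt_eq_rpow,
      show (-(1 / 4) + -(1 / 4) : ℝ) = -(1 / 2) by norm_num, rpow_neg hpos.le, ← div_eq_mul_inv, div_div]

/-- The coefficient of index `2s` of `σ`, in the normalisation of `Zmat`. -/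
noncomputable def evenCoeff (σ : ℝ → ℝ) (s : ℤ) : ℂ :=
  ((1 / (2 * π) : ℝ) : ℂ) *
    ∫ φ in (-π)..π, (σ φ : ℂ) * Complex.exp (Complex.I * ((2 * s : ℤ) : ℂ) * (φ : ℂ))

theorem Zmat_apply (σ : ℝ → ℝ) (ℓ : ℕ) (i k : Fin (ℓ - 1)) :
    Zmat σ ℓ i k = ((4 / π * freqWeight ℓ i * freqWeight ℓ k : ℝ) : ℂ) * evenCoeff σ (i - k) := by
  have hw : ∀ i : Fin (ℓ - 1), freqWeight ℓ i = (1 - scaledFreq ℓ i ^ 2) ^ (-(1 / 4) : ℝ) :=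
    fun i => if_pos (by omega)
  rw [hw, hw, evenCoeff, ← mul_assoc, ← Complex.ofReal_mul]
  rfl

theorem Zmat_residual_eq (σ : ℝ → ℝ) (ℓ : ℕ) (w : ℤ →₀ ℂ) (z : ℂ) (i j : Fin (ℓ - 1)) :
    (Zmat σ ℓ).mulVec (fun k => w ((k : ℤ) - j)) i - z * w ((i : ℤ) - j)
        - (Pi.single j 1 : Fin (ℓ - 1) → ℂ) i
      = localResidual (evenCoeff σ) w z ℓ j ((i : ℤ) - j) := by
  rw [localResidual]
  congr 1
  · congr 1
    rw [Matrix.mulVec, dotProduct, Finsupp.sum, add_sub_cancel]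
    refine sum_bij_ne_zero (fun k _ _ => (k : ℤ) - j) (fun k _ hk => ?_) (fun k _ _ k' _ _ h => ?_)
      (fun s _ hs => ?_) (fun k _ _ => ?_)
    · exact Finsupp.mem_support_iff.2 (right_ne_zero_of_mul hk)
    · exact Fin.ext (by omega)
    · have hw : freqWeight ℓ (j + s) ≠ 0 := fun h => hs (by simp [h])
      have hr : 0 ≤ (j : ℤ) + s ∧ (j : ℤ) + s < (ℓ : ℤ) - 1 := by
        by_contra hr
        exact hw (if_neg hr)
      have hk : ((((j : ℤ) + s).toNat : ℕ) : ℤ) = j + s := Int.toNat_of_nonneg hr.1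
      refine ⟨⟨((j : ℤ) + s).toNat, by omega⟩, mem_univ _, ?_, ?_⟩
      · rw [Zmat_apply]
        simp only [hk]
        convert hs using 3 <;> ring_nf
      · simp only [hk]
        ring
    · rw [Zmat_apply]
      congr 3 <;> ring_nf
  · simp only [Pi.single_apply, sub_eq_zero, Int.natCast_inj, Fin.val_inj]

theorem im_sq_mul_norm_resolvent_Zmat_sub_sq_le (σ : ℝ → ℝ) {ℓ : ℕ} (hH : (Zmat σ ℓ).IsHermitian)
    (w : ℤ →₀ ℂ) {z : ℂ} (hz : z.im ≠ 0) (j : Fin (ℓ - 1))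
    (hs : Summable fun t => ‖localResidual (evenCoeff σ) w z ℓ j t‖ ^ 2) :
    z.im ^ 2 * ‖hH.resolvent z j j - w 0‖ ^ 2
      ≤ ∑' t, ‖localResidual (evenCoeff σ) w z ℓ j t‖ ^ 2 := by
  have h := hH.im_sq_mul_norm_resolvent_sub_sq_le hz j (fun k => w ((k : ℤ) - j))
  rw [sub_self] at h
  refine h.trans ?_
  simp_rw [Zmat_residual_eq]
  have hinj : Function.Injective fun i : Fin (ℓ - 1) => (i : ℤ) - j :=
    fun a b hab => Fin.ext (by simpa using hab)
  rw [← tsum_fintype (L := SummationFilter.unconditional _)]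
  exact (Summable.of_finite).tsum_le_tsum_of_inj _ hinj (fun _ _ => by positivity)
    (fun _ => le_rfl) hs

theorem exists_norm_evenCoeff_le {σ : ℝ → ℝ} (hσ : ContDiff ℝ 1 σ)
    (hper : Function.Periodic σ (2 * π)) :
    ∃ C : ℝ, 0 ≤ C ∧ ∀ s, ‖evenCoeff σ s‖ ≤ C / (1 + |(s : ℝ)|) := by
  have hd : Continuous (deriv σ) := hσ.continuous_deriv le_rfl
  obtain ⟨M, hM⟩ := (isCompact_uIcc (a := -π) (b := π)).exists_bound_of_continuousOn hd.continuousOn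
  have hM0 : 0 ≤ M := (norm_nonneg _).trans (hM (-π) Set.left_mem_uIcc)
  refine ⟨‖evenCoeff σ 0‖ + M, by positivity, fun s => ?_⟩
  rcases eq_or_ne s 0 with rfl | hs
  · simpa using hM0
  have hs' : (s : ℂ) ≠ 0 := by exact_mod_cast hs
  have ha : Complex.I * ((2 * s : ℤ) : ℂ) ≠ 0 := by simpa using hs'
  set a : ℂ := Complex.I * ((2 * s : ℤ) : ℂ)
  have hexp : ∀ x : ℝ, ‖Complex.exp (a * x)‖ = 1 := by
    intro x
    rw [Complex.norm_exp]
    simp [a]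
  have hv : ∀ x : ℝ, HasDerivAt (fun x : ℝ => Complex.exp (a * x) / a) (Complex.exp (a * x)) x := by
    intro x
    have h := (((Complex.hasDerivAt_exp (a * x)).comp (x : ℂ)
      ((hasDerivAt_id (x : ℂ)).const_mul a)).comp_ofReal).div_const a
    simpa [ha] using h
  have hu : ∀ x : ℝ, HasDerivAt (fun x : ℝ => (σ x : ℂ)) ((deriv σ x : ℝ) : ℂ) x := fun x =>
    ((hσ.differentiable one_ne_zero x).hasDerivAt).ofReal_comp
  have hip := intervalIntegral.integral_mul_deriv_eq_deriv_mul (a := -π) (b := π)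
    (fun x _ => hu x) (fun x _ => hv x)
    (Continuous.intervalIntegrable (by fun_prop) _ _)
    (Continuous.intervalIntegrable (by fun_prop) _ _)
  have hbd : (σ π : ℂ) * (Complex.exp (a * π) / a)
      - (σ (-π) : ℂ) * (Complex.exp (a * (-π : ℝ)) / a) = 0 := by
    have h1 : σ π = σ (-π) := by
      rw [← hper (-π)]
      ring_nf
    have h2 : Complex.exp (a * π) = Complex.exp (a * (-π : ℝ)) := by
      rw [Complex.exp_eq_exp_iff_exists_int]
      refine ⟨2 * s, ?_⟩
      simp only [a]
      push_cast
      ring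
    rw [h1, h2, sub_self]
  rw [hbd, zero_sub] at hip
  have hna : ‖a‖ = 2 * |(s : ℝ)| := by
    simp [a, Complex.norm_intCast]
  have hs1 : 1 ≤ |(s : ℝ)| := by exact_mod_cast Int.one_le_abs hs
  have hint : ‖∫ x in (-π)..π, ((deriv σ x : ℝ) : ℂ) * (Complex.exp (a * x) / a)‖
      ≤ M / (2 * |(s : ℝ)|) * |π - -π| := by
    refine intervalIntegral.norm_integral_le_of_norm_le_const fun x hx => ?_
    rw [norm_mul, norm_div, hexp, hna, Complex.norm_real, mul_one_div]
    gcongr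
    exact hM x (Set.uIoc_subset_uIcc hx)
  rw [evenCoeff, hip, norm_mul, norm_neg, Complex.norm_real, norm_of_nonneg (by positivity)]
  have hpi : |π - -π| = 2 * π := by
    rw [abs_of_pos (by linarith [pi_pos])]
    ring
  rw [hpi] at hint
  calc 1 / (2 * π) * _ ≤ 1 / (2 * π) * (M / (2 * |(s : ℝ)|) * (2 * π)) := by gcongr
    _ = M / (2 * |(s : ℝ)|) := by field_simp
    _ ≤ _ := by
      gcongr
      · linarith [norm_nonneg (evenCoeff σ 0)]
      · linarith

theorem periodic_evenPart {σ : ℝ → ℝ} (hper : Function.Periodic σ (2 * π)) :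
    Function.Periodic (fun φ => (σ φ + σ (φ + π)) / 2) π := by
  intro φ
  have h : σ (φ + π + π) = σ φ := by
    rw [← hper φ]
    ring_nf
  simp only [h, add_comm (σ (φ + π))]

instance fact_zero_lt_pi : Fact (0 < π) := ⟨pi_pos⟩

theorem integral_haarAddCircle_eq {g : ℝ → ℂ} (hg : Function.Periodic g π) (hc : Continuous g)
    (H : AddCircle π → ℂ) (hH : ∀ φ : ℝ, H φ = g (-φ)) :
    ∫ x, H x ∂AddCircle.haarAddCircle = ((1 / (2 * π) : ℝ) : ℂ) * ∫ φ in (-π)..π, g φ := by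
  have h1 : ∫ x, H x ∂AddCircle.haarAddCircle = fourierCoeff H 0 := by simp [fourierCoeff]
  have h2 : ∫ φ in (-π)..π, g φ = 2 * ∫ φ in (-π)..0, g φ := by
    rw [← intervalIntegral.integral_add_adjacent_intervals (b := 0) (hc.intervalIntegrable _ _)
      (hc.intervalIntegrable _ _)]
    have := hg.intervalIntegral_add_eq 0 (-π)
    rw [zero_add, neg_add_cancel] at this
    rw [this]
    ring
  rw [h1, fourierCoeff_eq_intervalIntegral H 0 0, h2]
  simp only [neg_zero, fourier_zero, one_smul, hH, zero_add, intervalIntegral.integral_comp_neg,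
    Complex.real_smul]
  push_cast
  field_simp

theorem integral_mul_evenPart {σ : ℝ → ℝ} (hσ : Continuous σ) (hper : Function.Periodic σ (2 * π))
    {e : ℝ → ℂ} (he : Continuous e) (heper : Function.Periodic e π) :
    ∫ φ in (-π)..π, (σ φ : ℂ) * e φ = ∫ φ in (-π)..π, (((σ φ + σ (φ + π)) / 2 : ℝ) : ℂ) * e φ := by
  have hp : Function.Periodic (fun φ => (σ φ : ℂ) * e φ) (2 * π) := by
    intro φ
    have h : e (φ + 2 * π) = e φ := by
      rw [two_mul, ← add_assoc, heper, heper]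
    simp only [hper φ, h]
  have hshift : ∫ φ in (-π)..π, (σ (φ + π) : ℂ) * e φ = ∫ φ in (-π)..π, (σ φ : ℂ) * e φ := by
    have h1 := intervalIntegral.integral_comp_add_right (fun φ => (σ φ : ℂ) * e φ) π
      (a := -π) (b := π)
    have h2 := hp.intervalIntegral_add_eq 0 (-π)
    rw [show -π + 2 * π = π by ring, zero_add] at h2
    rw [neg_add_cancel, ← two_mul, h2] at h1
    simpa only [heper _] using h1
  have hsum : ∀ φ : ℝ, (((σ φ + σ (φ + π)) / 2 : ℝ) : ℂ) * e φ
      = 2⁻¹ * ((σ φ : ℂ) * e φ + (σ (φ + π) : ℂ) * e φ) := by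
    intro φ
    push_cast
    ring
  simp_rw [hsum]
  rw [intervalIntegral.integral_const_mul, intervalIntegral.integral_add
    (Continuous.intervalIntegrable (by fun_prop) _ _)
    (Continuous.intervalIntegrable (by fun_prop) _ _), hshift]
  ring

/-- The reflected even part of `σ` descends to the circle of length `π`, with Fourier coefficients
`evenCoeff σ`. -/
theorem exists_evenPart_circle {σ : ℝ → ℝ} (hσ : Continuous σ)
    (hper : Function.Periodic σ (2 * π)) :
    ∃ τ : C(AddCircle π, ℂ), (∀ φ : ℝ, τ φ = (((σ (-φ) + σ (-φ + π)) / 2 : ℝ) : ℂ)) ∧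
      ∀ s, fourierCoeff τ s = evenCoeff σ s := by
  have hp : Function.Periodic (fun φ : ℝ => (((σ (-φ) + σ (-φ + π)) / 2 : ℝ) : ℂ)) π := by
    intro φ
    have h := periodic_evenPart hper (-(φ + π))
    rw [neg_add, neg_add_cancel_right] at h
    simp only [neg_add]
    exact_mod_cast h.symm
  let τ : C(AddCircle π, ℂ) := ⟨hp.lift, Continuous.quotient_liftOn' (by fun_prop) _⟩
  have hτ : ∀ φ : ℝ, τ φ = (((σ (-φ) + σ (-φ + π)) / 2 : ℝ) : ℂ) := fun φ => rfl
  refine ⟨τ, hτ, fun s => ?_⟩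
  have he : Function.Periodic
      (fun φ : ℝ => Complex.exp (Complex.I * ((2 * s : ℤ) : ℂ) * (φ : ℂ))) π := by
    intro φ
    simp only
    rw [Complex.exp_eq_exp_iff_exists_int]
    refine ⟨s, ?_⟩
    push_cast
    ring
  rw [evenCoeff, integral_mul_evenPart hσ hper (by fun_prop) he]
  refine integral_haarAddCircle_eq (fun φ => ?_) (by fun_prop) _ fun φ => ?_
  · have h1 := he φ
    have h2 := periodic_evenPart hper φ
    simp only at h1 h2
    simp only [h1, h2]
  · rw [hτ, fourier_coe_apply, smul_eq_mul, mul_comm]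
    congr 2
    push_cast
    field_simp

/-- Convergence of the diagonal entries of the resolvent of `Zmat σ ℓ` along indices whose rescaled
frequency converges to an interior point `ξ`. -/
theorem tendsto_resolvent_Zmat_diag {σ : ℝ → ℝ} (hσ : ContDiff ℝ 1 σ)
    (hper : Function.Periodic σ (2 * π)) (hH : ∀ ℓ, (Zmat σ ℓ).IsHermitian) {z : ℂ} (hz : 0 < z.im)
    {j : ℕ → ℕ} {ξ : ℝ} (hξ : |ξ| < 1)
    (hj : Tendsto (fun n => scaledFreq n (j n)) atTop (𝓝 ξ)) :
    Tendsto (fun n => if h : j n < n - 1 then (hH n).resolvent z ⟨j n, h⟩ ⟨j n, h⟩ else 0) atTop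
      (𝓝 (((1 / (2 * π) : ℝ) : ℂ) * ∫ φ in (-π)..π,
        (((4 * ((σ φ + σ (φ + π)) / 2) / (π * √(1 - ξ ^ 2)) : ℝ) : ℂ) - z)⁻¹)) := by
  obtain ⟨C, hC, hc⟩ := exists_norm_evenCoeff_le hσ hper
  have hσc := hσ.continuous
  obtain ⟨τ, hτ, hτc⟩ := exists_evenPart_circle hσc hper
  set A : ℝ := 4 / (π * √(1 - ξ ^ 2)) with hA
  have hsym : ∀ φ : ℝ, 4 * ((σ φ + σ (φ + π)) / 2) / (π * √(1 - ξ ^ 2))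
      = A * ((σ φ + σ (φ + π)) / 2) := fun φ => by rw [hA]; ring
  simp_rw [hsym]
  have him : ∀ x, (((A : ℂ) • τ) x).im = 0 := by
    intro x
    induction x using QuotientAddGroup.induction_on with
    | H φ =>
      change ((A : ℂ) * τ (φ : AddCircle π)).im = 0
      rw [hτ, ← Complex.ofReal_mul, Complex.ofReal_im]
  have hne : ∀ r : ℝ, (r : ℂ) - z ≠ 0 := fun r h => hz.ne' <| by
    simpa using congrArg Complex.im h
  have hint := integral_haarAddCircle_eq
    (g := fun φ => (((A * ((σ φ + σ (φ + π)) / 2) : ℝ) : ℂ) - z)⁻¹)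
    (fun φ => by have h := periodic_evenPart hper φ; simp only at h; simp only [h])
    (by fun_prop (disch := exact fun _ => hne _)) (fun x => (((A : ℂ) • τ) x - z)⁻¹)
    (fun φ => by simp [hτ])
  rw [← hint, Metric.tendsto_nhds]
  intro η hη
  set ε : ℝ := η / (2 * (2 / z.im + 1)) with hε_def
  have hε : 0 < ε := by positivity
  obtain ⟨w, hw1, hw2⟩ := exists_finsupp_approx_resolvent ((A : ℂ) • τ) him hz hε
  have hcoef : ∀ n, fourierCoeff ((A : ℂ) • τ : C(AddCircle π, ℂ)) n = A * evenCoeff σ n := by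
    intro n
    rw [← hτc]
    exact fourierCoeff.const_smul _ _ _
  simp_rw [hcoef] at hw1
  obtain ⟨hsum, hlim⟩ := tendsto_tsum_localResidual hC hc w z hξ hj
  filter_upwards [hsum,
    hlim.eventually_lt_const (hw1.trans_lt (by nlinarith : ε ^ 2 < (2 * ε) ^ 2)),
    hj.abs.eventually_lt_const hξ, eventually_gt_atTop 0] with n hsn hln hjn hn
  have hr := mem_range_of_abs_scaledFreq_lt_one hn hjn
  have hjlt : j n < n - 1 := by omega
  rw [dif_pos hjlt]
  have hmain := (im_sq_mul_norm_resolvent_Zmat_sub_sq_le σ (hH n) w hz.ne' ⟨j n, hjlt⟩ hsn).trans_lt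
    hln
  rw [← mul_pow] at hmain
  have hmain := lt_of_pow_lt_pow_left₀ 2 (by positivity) hmain
  rw [← lt_div_iff₀' hz] at hmain
  have hsplit := dist_triangle ((hH n).resolvent z ⟨j n, hjlt⟩ ⟨j n, hjlt⟩) (w 0)
    (∫ x, (((A : ℂ) • τ) x - z)⁻¹ ∂AddCircle.haarAddCircle)
  rw [← dist_eq_norm] at hmain hw2
  calc _ ≤ _ := hsplit
    _ ≤ 2 * ε / z.im + ε := add_le_add hmain.le hw2
    _ = η / 2 := by
      rw [hε_def]
      field_simp
    _ < η := by linarith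

theorem tendsto_scaledFreq_floor {x : ℝ} (hx : 0 ≤ x) :
    Tendsto (fun n : ℕ => scaledFreq n (⌊x * (n + 1)⌋₊ : ℕ)) atTop (𝓝 (2 * x - 1)) := by
  have h1 : Tendsto (fun n : ℕ => (⌊x * ((n : ℝ) + 1)⌋₊ : ℝ) / ((n : ℝ) + 1)) atTop (𝓝 x) :=
    (tendsto_nat_floor_mul_div_atTop hx).comp
      (tendsto_atTop_add_const_right _ 1 tendsto_natCast_atTop_atTop)
  have h2 : Tendsto (fun n : ℕ => 1 + 1 / (n : ℝ)) atTop (𝓝 1) := by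
    simpa using (tendsto_const_div_atTop_nhds_zero_nat (1 : ℝ)).const_add 1
  have h3 := (((h1.mul h2).const_mul 2).sub_const 1).add
    (tendsto_const_div_atTop_nhds_zero_nat (2 : ℝ))
  rw [mul_one, add_zero] at h3
  refine h3.congr' ?_
  filter_upwards [eventually_gt_atTop 0] with n hn
  have hn' : (n : ℝ) ≠ 0 := by positivity
  rw [scaledFreq]
  push_cast
  field_simp

theorem tendsto_average_resolvent_Zmat {σ : ℝ → ℝ} (hσ : ContDiff ℝ 1 σ)
    (hper : Function.Periodic σ (2 * π)) (hH : ∀ ℓ, (Zmat σ ℓ).IsHermitian) {z : ℂ}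
    (hz : 0 < z.im) :
    Tendsto (fun n : ℕ => ((n : ℂ) + 1)⁻¹ * ∑ k, (((hH n).eigenvalues k : ℂ) - z)⁻¹) atTop
      (𝓝 (((1 / (4 * π) : ℝ) : ℂ) * ∫ ξ in (-1 : ℝ)..1, ∫ φ in (-π)..π,
        (((4 * ((σ φ + σ (φ + π)) / 2) / (π * √(1 - ξ ^ 2)) : ℝ) : ℂ) - z)⁻¹)) := by
  set r : ℝ → ℂ := fun ξ => ∫ φ in (-π)..π,
    (((4 * ((σ φ + σ (φ + π)) / 2) / (π * √(1 - ξ ^ 2)) : ℝ) : ℂ) - z)⁻¹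
  have h := tendsto_average_of_tendsto_floor (C := z.im⁻¹)
    (F := fun n j => if h : j < n - 1 then (hH n).resolvent z ⟨j, h⟩ ⟨j, h⟩ else 0)
    (G := fun x => ((1 / (2 * π) : ℝ) : ℂ) * r (2 * x - 1)) (fun n j => ?_) fun x hx => ?_
  · convert h using 2
    · rename_i n
      congr 1
      rw [← Matrix.IsHermitian.trace_resolvent, Matrix.trace]
      have hsub : range (n - 1) ⊆ range (n + 1) := range_subset_range.2 (by omega)
      rw [← sum_subset hsub fun j _ hj => dif_neg (by simpa using hj), sum_range]
      refine sum_congr rfl fun k _ => ?_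
      rw [dif_pos k.2]
      rfl
    · rw [intervalIntegral.integral_const_mul,
        intervalIntegral.integral_comp_mul_sub r two_ne_zero 1]
      norm_num [Complex.real_smul]
      ring
  · split_ifs with hj
    · exact (hH n).norm_resolvent_apply_self_le hz _
    · simpa using hz.le
  · refine tendsto_resolvent_Zmat_diag hσ hper hH hz ?_ (tendsto_scaledFreq_floor hx.1.le)
    rw [abs_lt]
    constructor <;> linarith [hx.1, hx.2]

theorem measurable_symbol {σ : ℝ → ℝ} (hσ : Continuous σ) :
    Measurable fun p : ℝ × ℝ => 4 * ((σ p.1 + σ (p.1 + π)) / 2) / (π * √(1 - p.2 ^ 2)) := by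
  have := hσ.measurable
  fun_prop

theorem Zmat_trace_asymptotics
    (σ : ℝ → ℝ) (hσ : ContDiff ℝ 1 σ) (hper : Function.Periodic σ (2*Real.pi))
    (hH : ∀ ℓ : ℕ, (Zmat σ ℓ).IsHermitian)
    (f : ℝ → ℝ) (hf : ContDiff ℝ (⊤ : ℕ∞) f) (hsupp : HasCompactSupport f) (hf0 : f 0 = 0) :
    Tendsto
      (fun ℓ : ℕ => (1/((ℓ:ℝ)+1)) * ∑ k, f ((hH ℓ).eigenvalues k))
      atTop
      (nhds ((1/(4*Real.pi)) *
        ∫ φ in (-Real.pi)..Real.pi, ∫ ξ in (-1:ℝ)..(1:ℝ),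
          f (4 * ((σ φ + σ (φ + Real.pi))/2) / (Real.pi * Real.sqrt (1 - ξ^2))))) := by
  let S : ℝ × ℝ → ℝ := fun p => 4 * ((σ p.1 + σ (p.1 + π)) / 2) / (π * √(1 - p.2 ^ 2))
  have hS : Measurable S := measurable_symbol hσ.continuous
  let ν : Measure (ℝ × ℝ) :=
    (volume.restrict (Set.Ioc (-π) π)).prod (volume.restrict (Set.Ioc (-1) 1))
  let μ : Measure ℝ := ENNReal.ofReal (1 / (4 * π)) • ν.map S
  let μs : ℕ → Measure ℝ := fun n =>
    ENNReal.ofReal (1 / ((n : ℝ) + 1)) • ∑ k, Measure.dirac ((hH n).eigenvalues k)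
  have hfin : ∀ n, IsFiniteMeasure (μs n) := fun n =>
    Measure.smul_finite _ ENNReal.ofReal_ne_top
  have hfinμ : IsFiniteMeasure μ := Measure.smul_finite _ ENNReal.ofReal_ne_top
  have hμs : ∀ (n : ℕ) {E : Type} [NormedAddCommGroup E] [NormedSpace ℝ E] [CompleteSpace E]
      (g : ℝ → E), ∫ x, g x ∂μs n = (1 / ((n : ℝ) + 1)) • ∑ k, g ((hH n).eigenvalues k) := by
    intro n E _ _ _ g
    rw [integral_smul_measure, ENNReal.toReal_ofReal (by positivity),
      integral_finsetSum_measure fun k _ => integrable_dirac enorm_lt_top]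
    simp
  have hmass : ∀ n, (μs n).real Set.univ ≤ 1 := by
    intro n
    have h := hμs n fun _ => (1 : ℝ)
    simp only [integral_const, smul_eq_mul, mul_one, sum_const, card_univ, Fintype.card_fin,
      nsmul_eq_mul] at h
    rw [h, one_div, inv_mul_le_one₀ (by positivity)]
    exact_mod_cast (Nat.sub_le n 1).trans n.le_succ
  have hmassμ : μ.real Set.univ ≤ 1 := by
    have hν : ν.real Set.univ = 4 * π := by
      rw [← Set.univ_prod_univ, measureReal_prod_prod]
      simp [Real.pi_pos.le, ← two_mul]
      ring
    rw [measureReal_ennreal_smul_apply, map_measureReal_apply hS .univ, Set.preimage_univ, hν,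
      ENNReal.toReal_ofReal (by positivity)]
    field_simp
    rfl
  have hμ : ∀ {E : Type} [NormedAddCommGroup E] [NormedSpace ℝ E] {g : ℝ → E},
      Integrable g μ → Integrable (fun p => g (S p)) ν ∧
        ∫ x, g x ∂μ = (1 / (4 * π)) • ∫ p, g (S p) ∂ν := by
    intro E _ _ g hg
    have hg' : Integrable g (ν.map S) := by
      rwa [integrable_smul_measure (by simp [Real.pi_pos]) ENNReal.ofReal_ne_top] at hg
    refine ⟨hg'.comp_measurable hS, ?_⟩
    rw [integral_smul_measure, ENNReal.toReal_ofReal (by positivity),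
      integral_map hS.aemeasurable hg'.aestronglyMeasurable]
  have h := tendsto_integral_of_tendsto_stieltjes hmass hmassμ (fun z hz => ?_) hf.continuous hsupp
  · obtain ⟨hint, heq⟩ := hμ (hf.continuous.integrable_of_hasCompactSupport hsupp)
    rw [heq, integral_prod _ hint] at h
    simp_rw [hμs, smul_eq_mul] at h
    convert h using 3
    rw [intervalIntegral.integral_of_le (by linarith [Real.pi_pos])]
    refine integral_congr_ae (.of_forall fun φ => ?_)
    exact intervalIntegral.integral_of_le (by norm_num)
  · obtain ⟨hint, heq⟩ := hμ (integrable_inv_ofReal_sub μ hz)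
    rw [heq, integral_prod_symm _ hint]
    have h := tendsto_average_resolvent_Zmat hσ hper hH hz
    simp_rw [hμs, Complex.real_smul]
    convert h using 2
    · push_cast
      rw [one_div]
    · congr 1
      rw [intervalIntegral.integral_of_le (by norm_num)]
      refine integral_congr_ae (.of_forall fun ξ => ?_)
      exact (intervalIntegral.integral_of_le (by linarith [Real.pi_pos])).symm
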